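/- arXiv:quant-ph/0505090 — 2 statements merged into one kernel-verified Lean document; each statement's English description precedes it below -/
import Mathlib

section
/- Let {p_i, ρ_i} be an ensemble of letter states on a finite alphabet A with average state η_i, and let I be an instrument with finite outcome set Ω, operations O(ω) and POV measure E. Then I_c{p_i, ρ_i; E} + Σ_{α: p_i(α)>0} p_i(α) χ{p_{f|i}(·|α), ρ_f^α} ≥ χ{p_f, ρ_f}, where ρ_f^α(ω) = O(ω)[ρ_i(α)]/p_{f|i}(ω|α), ρ_f(ω) = O(ω)[η_i]/p_f(ω), the ensemble {p_{f|i}(·|α), ρ_f^α} has average state η_f^α = Σ_ω O(ω)[ρ_i(α)], and {p_f, ρ_f} has average state η_f = Σ_ω O(ω)[η_i]. -/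
open Matrix Finset
open scoped BigOperators ComplexOrder

noncomputable section

/-- Matrix logarithm of a Hermitian matrix via the spectral decomposition
(with the convention `Real.log 0 = 0` on the kernel); `0` for non-Hermitian matrices. -/
def matLog {d : ℕ} (A : Matrix (Fin d) (Fin d) ℂ) : Matrix (Fin d) (Fin d) ℂ :=
  if hA : A.IsHermitian then
    (hA.eigenvectorUnitary : Matrix (Fin d) (Fin d) ℂ) *
      Matrix.diagonal (fun i => (Real.log (hA.eigenvalues i) : ℂ)) *
      star (hA.eigenvectorUnitary : Matrix (Fin d) (Fin d) ℂ)
  else 0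

/-- The von Neumann entropy `S_q(ρ) = −Tr(ρ log ρ)`. -/
def vnEntropy {d : ℕ} (ρ : Matrix (Fin d) (Fin d) ℂ) : ℝ :=
  -(Matrix.trace (ρ * matLog ρ)).re

/-- The quantum relative entropy `S_q(ρ‖φ) = Tr(ρ (log ρ − log φ))`. -/
def qRelEntropy {d : ℕ} (ρ φ : Matrix (Fin d) (Fin d) ℂ) : ℝ :=
  (Matrix.trace (ρ * (matLog ρ - matLog φ))).re

/-- The classical relative entropy `S_c(p‖q) = Σ_{ω : p ω > 0} p ω log (p ω / q ω)`. -/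
def cRelEntropy {Ω : Type*} [Fintype Ω] (p q : Ω → ℝ) : ℝ :=
  ∑ ω ∈ Finset.univ.filter (fun ω => 0 < p ω), p ω * Real.log (p ω / q ω)

/-- The probability of outcome `ω` for POV measure `E` in the state `ρ`. -/
def povProb {d : ℕ} {Ω : Type*} (E : Ω → Matrix (Fin d) (Fin d) ℂ)
    (ρ : Matrix (Fin d) (Fin d) ℂ) (ω : Ω) : ℝ :=
  (Matrix.trace (E ω * ρ)).re

/-- The χ-quantity of the ensemble `{p, σ}` (relative entropies w.r.t. the average state). -/
def chiQuantity {d : ℕ} {X : Type*} [Fintype X] (p : X → ℝ)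
    (σ : X → Matrix (Fin d) (Fin d) ℂ) : ℝ :=
  ∑ x ∈ Finset.univ.filter (fun x => 0 < p x),
    p x * qRelEntropy (σ x) (∑ y, p y • σ y)

/-- The operation `O(ω)[ρ] = Σ_k V_k^ω ρ (V_k^ω)†` of the instrument with Kraus family `V`. -/
def instrOp {d : ℕ} {Ω K : Type*} [Fintype K] (V : Ω → K → Matrix (Fin d) (Fin d) ℂ)
    (ω : Ω) (ρ : Matrix (Fin d) (Fin d) ℂ) : Matrix (Fin d) (Fin d) ℂ :=
  ∑ k, V ω k * ρ * (V ω k)ᴴ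

/-- The POV measure `E(ω) = Σ_k (V_k^ω)† V_k^ω` associated with the instrument `V`. -/
def instrPOV {d : ℕ} {Ω K : Type*} [Fintype K] (V : Ω → K → Matrix (Fin d) (Fin d) ℂ)
    (ω : Ω) : Matrix (Fin d) (Fin d) ℂ :=
  ∑ k, (V ω k)ᴴ * V ω k

/-- The outcome probability `p_ρ(ω) = Tr(E(ω) ρ)` of the instrument `V`. -/
def outcomeProb {d : ℕ} {Ω K : Type*} [Fintype K] (V : Ω → K → Matrix (Fin d) (Fin d) ℂ)
    (ρ : Matrix (Fin d) (Fin d) ℂ) (ω : Ω) : ℝ :=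
  (Matrix.trace (instrPOV V ω * ρ)).re

/-- The a posteriori state `π_ρ(ω) = O(ω)[ρ] / p_ρ(ω)` of the instrument `V`. -/
def postState {d : ℕ} {Ω K : Type*} [Fintype K] (V : Ω → K → Matrix (Fin d) (Fin d) ℂ)
    (ρ : Matrix (Fin d) (Fin d) ℂ) (ω : Ω) : Matrix (Fin d) (Fin d) ℂ :=
  (outcomeProb V ρ ω)⁻¹ • instrOp V ω ρ

/-- The classical input/output mutual information `I_c{p, ρ; E}` for the ensemble `{p, ρ}`
measured with the POV measure `E`. -/
def mutualInfo {d : ℕ} {A Ω : Type*} [Fintype A] [Fintype Ω]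
    (p : A → ℝ) (ρ : A → Matrix (Fin d) (Fin d) ℂ)
    (E : Ω → Matrix (Fin d) (Fin d) ℂ) : ℝ :=
  ∑ x ∈ Finset.univ.filter (fun x : A × Ω => 0 < p x.1 * povProb E (ρ x.1) x.2),
    (p x.1 * povProb E (ρ x.1) x.2) *
      Real.log ((p x.1 * povProb E (ρ x.1) x.2) /
        (p x.1 * povProb E (∑ α, p α • ρ α) x.2))

/-- The quantum information gain `I_q(ρ; I)` of the instrument `V` on the state `ρ`. -/
def infoGain {d : ℕ} {Ω K : Type*} [Fintype Ω] [Fintype K]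
    (V : Ω → K → Matrix (Fin d) (Fin d) ℂ) (ρ : Matrix (Fin d) (Fin d) ℂ) : ℝ :=
  vnEntropy ρ - ∑ ω ∈ Finset.univ.filter (fun ω => 0 < outcomeProb V ρ ω),
    outcomeProb V ρ ω * vnEntropy (postState V ρ ω)

/-- A pure state: a rank-one orthogonal projection. -/
def IsPureState {d : ℕ} (ρ : Matrix (Fin d) (Fin d) ℂ) : Prop :=
  ρ.IsHermitian ∧ ρ * ρ = ρ ∧ ρ.rank = 1

end
/-- The unitary `U` diagonalizes `X`, with real eigenvalues `x`. -/
def IsSpectralDecomp {d : ℕ} (X U : Matrix (Fin d) (Fin d) ℂ) (x : Fin d → ℝ) : Prop :=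
  Uᴴ * U = 1 ∧ U * Uᴴ = 1 ∧ X = U * diagonal (fun i => (x i : ℂ)) * Uᴴ

lemma Matrix.IsHermitian.isSpectralDecomp {d : ℕ} {X : Matrix (Fin d) (Fin d) ℂ}
    (hX : X.IsHermitian) :
    IsSpectralDecomp X (hX.eigenvectorUnitary : Matrix (Fin d) (Fin d) ℂ) hX.eigenvalues := by
  refine ⟨Unitary.coe_star_mul_self hX.eigenvectorUnitary,
    Unitary.coe_mul_star_self hX.eigenvectorUnitary, ?_⟩
  exact hX.spectral_theorem

lemma Matrix.PosSemidef.exists_isSpectralDecomp {d : ℕ} {X : Matrix (Fin d) (Fin d) ℂ}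
    (hX : X.PosSemidef) : ∃ U x, IsSpectralDecomp X U x ∧ ∀ i, 0 ≤ x i :=
  ⟨_, _, hX.1.isSpectralDecomp, hX.eigenvalues_nonneg⟩

namespace IsSpectralDecomp

variable {d : ℕ} {X Y U W : Matrix (Fin d) (Fin d) ℂ} {x y : Fin d → ℝ}

lemma isHermitian (h : IsSpectralDecomp X U x) : X.IsHermitian := by
  rw [h.2.2]
  apply Matrix.isHermitian_mul_mul_conjTranspose
  exact isHermitian_diagonal_of_self_adjoint _ (funext fun i => by simp)

lemma smul (h : IsSpectralDecomp X U x) (a : ℝ) :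
    IsSpectralDecomp (a • X) U (fun i => a * x i) := by
  refine ⟨h.1, h.2.1, ?_⟩
  have : diagonal (fun i => ((a * x i : ℝ) : ℂ)) = a • diagonal (fun i => (x i : ℂ)) := by
    ext i j
    by_cases hij : i = j <;> simp [hij]
  rw [this, h.2.2]
  simp

/-- A function of the eigenvalues does not depend on the chosen diagonalization. -/
lemma map_unique (h : IsSpectralDecomp X U x) (h' : IsSpectralDecomp X W y) (f : ℝ → ℝ) :
    U * diagonal (fun i => (f (x i) : ℂ)) * Uᴴ = W * diagonal (fun i => (f (y i) : ℂ)) * Wᴴ := by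
  have key : (Wᴴ * U) * diagonal (fun i => (x i : ℂ)) =
      diagonal (fun i => (y i : ℂ)) * (Wᴴ * U) := by
    calc _ = Wᴴ * (U * diagonal (fun i => (x i : ℂ)) * Uᴴ) * U := by
            simp only [Matrix.mul_assoc, h.1, Matrix.mul_one]
      _ = Wᴴ * (W * diagonal (fun i => (y i : ℂ)) * Wᴴ) * U := by rw [← h.2.2, h'.2.2]
      _ = _ := by simp only [← Matrix.mul_assoc, h'.1, Matrix.one_mul]
  have key2 : (Wᴴ * U) * diagonal (fun i => (f (x i) : ℂ)) =
      diagonal (fun i => (f (y i) : ℂ)) * (Wᴴ * U) := by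
    ext i j
    have := congrFun (congrFun key i) j
    rw [mul_diagonal, diagonal_mul] at this ⊢
    by_cases hM : (Wᴴ * U) i j = 0
    · simp [hM]
    · have hxy : (x j : ℂ) = y i := by
        apply mul_left_cancel₀ hM
        rw [this, mul_comm]
      rw [Complex.ofReal_inj.mp hxy, mul_comm]
  calc _ = W * ((Wᴴ * U) * diagonal (fun i => (f (x i) : ℂ))) * Uᴴ := by
          simp only [← Matrix.mul_assoc, h'.2.1, Matrix.one_mul]
    _ = _ := by rw [key2]; simp only [Matrix.mul_assoc, h.2.1, Matrix.mul_one]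

lemma matLog_eq (h : IsSpectralDecomp X U x) :
    matLog X = U * diagonal (fun i => (Real.log (x i) : ℂ)) * Uᴴ := by
  rw [matLog, dif_pos h.isHermitian]
  exact h.isHermitian.isSpectralDecomp.map_unique h Real.log

lemma trace_mul (a b : Fin d → ℝ) :
    (trace ((U * diagonal (fun i => (a i : ℂ)) * Uᴴ) *
      (W * diagonal (fun i => (b i : ℂ)) * Wᴴ))).re =
      ∑ i, ∑ j, Complex.normSq ((Uᴴ * W) i j) * (a i * b j) := by
  have h1 : trace ((U * diagonal (fun i => (a i : ℂ)) * Uᴴ) *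
      (W * diagonal (fun i => (b i : ℂ)) * Wᴴ)) =
      trace ((diagonal (fun i => (a i : ℂ)) * (Uᴴ * W)) *
        (diagonal (fun i => (b i : ℂ)) * (Uᴴ * W)ᴴ)) := by
    rw [Matrix.mul_assoc, Matrix.mul_assoc, Matrix.trace_mul_comm]
    simp [Matrix.mul_assoc]
  rw [h1, trace, Complex.re_sum]
  refine sum_congr rfl fun i _ => ?_
  rw [diag_apply, mul_apply, Complex.re_sum]
  refine sum_congr rfl fun j _ => ?_
  rw [diagonal_mul, diagonal_mul, conjTranspose_apply]
  simp [Complex.normSq_apply]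
  ring

lemma trace_left (h : IsSpectralDecomp X U x) (hW : W * Wᴴ = 1) :
    (trace X).re = ∑ i, ∑ j, Complex.normSq ((Uᴴ * W) i j) * x i := by
  have := trace_mul (U := U) (W := W) x (fun _ => 1)
  simpa [← h.2.2, hW] using this

lemma trace_right (h : IsSpectralDecomp Y W y) (hU : U * Uᴴ = 1) :
    (trace Y).re = ∑ i, ∑ j, Complex.normSq ((Uᴴ * W) i j) * y j := by
  have := trace_mul (U := U) (W := W) (fun _ => 1) y
  simpa [← h.2.2, hU] using this

lemma qRelEntropy_eq (h : IsSpectralDecomp X U x) (h' : IsSpectralDecomp Y W y) :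
    qRelEntropy X Y = ∑ i, ∑ j, Complex.normSq ((Uᴴ * W) i j) *
      (x i * Real.log (x i) - x i * Real.log (y j)) := by
  have h1 : (trace (X * matLog X)).re =
      ∑ i, ∑ j, Complex.normSq ((Uᴴ * W) i j) * (x i * Real.log (x i)) := by
    have : X * matLog X = (U * diagonal (fun i => ((x i * Real.log (x i) : ℝ) : ℂ)) * Uᴴ) *
        (W * diagonal (fun _ => ((1 : ℝ) : ℂ)) * Wᴴ) := by
      rw [h.matLog_eq]
      nth_rw 1 [h.2.2]
      calc _ = U * (diagonal (fun i => (x i : ℂ)) * (Uᴴ * U) *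
              diagonal (fun i => (Real.log (x i) : ℂ))) * Uᴴ := by
            simp only [Matrix.mul_assoc]
        _ = _ := by simp [h.1, h'.2.1]
    rw [this, trace_mul]
    simp
  have h2 : (trace (X * matLog Y)).re =
      ∑ i, ∑ j, Complex.normSq ((Uᴴ * W) i j) * (x i * Real.log (y j)) := by
    rw [h'.matLog_eq, ← trace_mul, ← h.2.2]
  rw [qRelEntropy, Matrix.mul_sub, trace_sub, Complex.sub_re, h1, h2]
  simp only [← sum_sub_distrib, mul_sub]

lemma mulVec_col (h : IsSpectralDecomp Y W y) (j : Fin d) :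
    Y *ᵥ (fun i => W i j) = fun i => W i j * y j := by
  have : Y * W = W * diagonal (fun i => (y i : ℂ)) := by
    nth_rw 1 [h.2.2]
    simp only [Matrix.mul_assoc, h.1, Matrix.mul_one]
  ext i
  have := congrFun (congrFun this i) j
  rwa [mul_diagonal] at this

lemma normSq_mul_eq_zero (h : IsSpectralDecomp X U x) (h' : IsSpectralDecomp Y W y)
    (hker : ∀ v, Y *ᵥ v = 0 → X *ᵥ v = 0) (i j : Fin d) (hj : y j = 0) :
    Complex.normSq ((Uᴴ * W) i j) * x i = 0 := by
  have h1 : X *ᵥ (fun i => W i j) = 0 := hker _ (by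
    rw [h'.mulVec_col]
    simp only [hj, Complex.ofReal_zero, mul_zero]
    rfl)
  have h2 : (Uᴴ * (X * W)) i j = 0 := by
    rw [mul_apply]
    refine sum_eq_zero fun k _ => ?_
    have : (X * W) k j = 0 := congrFun h1 k
    rw [this, mul_zero]
  have h3 : Uᴴ * (X * W) = diagonal (fun i => (x i : ℂ)) * (Uᴴ * W) := by
    nth_rw 1 [h.2.2]
    simp only [← Matrix.mul_assoc, h.1, Matrix.one_mul]
  rw [h3, diagonal_mul] at h2
  rcases mul_eq_zero.mp h2 with h0 | h0
  · simp [Complex.ofReal_eq_zero.mp h0]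
  · simp [h0]

end IsSpectralDecomp

lemma qRelEntropy_smul_smul {d : ℕ} {X Y : Matrix (Fin d) (Fin d) ℂ} (hX : X.PosSemidef)
    (hY : Y.PosSemidef) (hker : ∀ v, Y *ᵥ v = 0 → X *ᵥ v = 0) {a b : ℝ} (ha : 0 < a)
    (hb : 0 < b) :
    qRelEntropy (a • X) (b • Y) =
      a * (qRelEntropy X Y + Real.log (a / b) * (trace X).re) := by
  obtain ⟨U, x, hU, hx⟩ := hX.exists_isSpectralDecomp
  obtain ⟨W, y, hW, hy⟩ := hY.exists_isSpectralDecomp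
  rw [(hU.smul a).qRelEntropy_eq (hW.smul b), hU.qRelEntropy_eq hW, hU.trace_left hW.2.1, mul_sum,
    ← sum_add_distrib, mul_sum]
  refine sum_congr rfl fun i _ => ?_
  rw [mul_sum, ← sum_add_distrib, mul_sum]
  refine sum_congr rfl fun j _ => ?_
  have h0 := hU.normSq_mul_eq_zero hW hker i j
  rcases eq_or_ne (x i) 0 with hxi | hxi
  · simp [hxi]
  rcases eq_or_ne (y j) 0 with hyj | hyj
  · have := (mul_eq_zero.mp (h0 hyj)).resolve_right hxi
    simp [this]
  rw [Real.log_mul ha.ne' hxi, Real.log_mul hb.ne' hyj, Real.log_div ha.ne' hb.ne']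
  ring

lemma intervalIntegral_relEntropy {c x y : ℝ} (hc : 0 ≤ c) (hx : 0 ≤ x) (hy : 0 ≤ y)
    (hxy : y = 0 → c * x = 0) :
    IntervalIntegrable (fun s : ℝ => c * ((1 - s) * ((x - y) ^ 2 / (s * x + (1 - s) * y))))
      MeasureTheory.volume 0 1 ∧
    ∫ s in (0 : ℝ)..1, c * ((1 - s) * ((x - y) ^ 2 / (s * x + (1 - s) * y))) =
      c * (x * Real.log x - x * Real.log y - x + y) := by
  rcases hc.eq_or_lt with rfl | hc
  · simp
  rcases hy.eq_or_lt with rfl | hy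
  · have : x = 0 := (mul_eq_zero.mp (hxy rfl)).resolve_left hc.ne'
    simp [this]
  have hpos : ∀ s ∈ Set.Ioo (0 : ℝ) 1, 0 < s * x + (1 - s) * y := fun s hs =>
    add_pos_of_nonneg_of_pos (mul_nonneg hs.1.le hx) (mul_pos (sub_pos.2 hs.2) hy)
  set G : ℝ → ℝ := fun s =>
    c * (x * Real.log (s * x + (1 - s) * y) - (s * x + (1 - s) * y)) with hG
  have hcont : ContinuousOn G (Set.Icc 0 1) := by
    rcases hx.eq_or_lt with rfl | hx
    · simp only [hG, zero_mul, zero_sub]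
      fun_prop
    · have : ∀ s ∈ Set.Icc (0 : ℝ) 1, s * x + (1 - s) * y ≠ 0 := fun s hs => by
        rcases hs.1.eq_or_lt with rfl | h0
        · simpa using hy.ne'
        · exact (add_pos_of_pos_of_nonneg (mul_pos h0 hx)
            (mul_nonneg (sub_nonneg.2 hs.2) hy.le)).ne'
      fun_prop (disch := assumption)
  have hderiv : ∀ s ∈ Set.Ioo (0 : ℝ) 1, HasDerivAt G
      (c * ((1 - s) * ((x - y) ^ 2 / (s * x + (1 - s) * y)))) s := fun s hs => by
    have h1 : HasDerivAt (fun s : ℝ => s * x + (1 - s) * y) (x - y) s := by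
      have := ((hasDerivAt_id s).mul_const x).add (((hasDerivAt_id s).const_sub 1).mul_const y)
      refine this.congr_deriv ?_
      ring
    have h2 := (((h1.log (hpos s hs).ne').const_mul x).sub h1).const_mul c
    refine h2.congr_deriv ?_
    have hw := (hpos s hs).ne'
    have hxw : x - (s * x + (1 - s) * y) = (1 - s) * (x - y) := by ring
    generalize s * x + (1 - s) * y = w at hw hxw ⊢
    calc c * (x * ((x - y) / w) - (x - y)) = c * ((x - w) * ((x - y) / w)) := by
          field_simp
      _ = c * ((1 - s) * ((x - y) ^ 2 / w)) := by
          rw [hxw]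
          ring
  have hint : IntervalIntegrable (fun s : ℝ =>
      c * ((1 - s) * ((x - y) ^ 2 / (s * x + (1 - s) * y)))) MeasureTheory.volume 0 1 := by
    apply intervalIntegral.intervalIntegrable_deriv_of_nonneg (g := G)
    · rwa [Set.uIcc_of_le zero_le_one]
    · simpa using hderiv
    · intro s hs
      simp only [zero_le_one, inf_of_le_left, sup_of_le_right] at hs
      have := hpos s hs
      have := sub_pos.2 hs.2
      positivity
  refine ⟨hint, ?_⟩
  rw [intervalIntegral.integral_eq_sub_of_hasDerivAt_of_le zero_le_one hcont hderiv hint]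
  simp only [hG, one_mul, sub_self, zero_mul, add_zero, zero_add, sub_zero]
  ring

/-- A quadratic functional of `Z`, real-linear in `(X, Y)`, whose supremum over `Z` is the
integrand of an integral representation of the relative entropy. -/
noncomputable def quadFunctional {d : ℕ} (s : ℝ) (Z X Y : Matrix (Fin d) (Fin d) ℂ) : ℝ :=
  2 * (trace (Zᴴ * (X - Y))).re - s * (trace (Zᴴ * X * Z)).re -
    (1 - s) * (trace (Z * Y * Zᴴ)).re

lemma quadFunctional_sum {d : ℕ} {ι : Type*} (t : Finset ι) (s : ℝ)
    (Z : Matrix (Fin d) (Fin d) ℂ) (X Y : ι → Matrix (Fin d) (Fin d) ℂ) :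
    quadFunctional s Z (∑ i ∈ t, X i) (∑ i ∈ t, Y i) =
      ∑ i ∈ t, quadFunctional s Z (X i) (Y i) := by
  simp only [quadFunctional, ← sum_sub_distrib, mul_sum, Matrix.sum_mul, trace_sum,
    Complex.re_sum]

lemma quadFunctional_eq {d : ℕ} {X Y U W : Matrix (Fin d) (Fin d) ℂ} {x y : Fin d → ℝ}
    (h : IsSpectralDecomp X U x) (h' : IsSpectralDecomp Y W y) (s : ℝ)
    (N : Matrix (Fin d) (Fin d) ℂ) :
    quadFunctional s (U * N * Wᴴ) X Y = ∑ i, ∑ j,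
      (2 * (star (N i j) * (Uᴴ * W) i j).re * (x i - y j) -
        (s * x i + (1 - s) * y j) * Complex.normSq (N i j)) := by
  have e1 : (trace ((U * N * Wᴴ)ᴴ * (X - Y))).re =
      ∑ i, ∑ j, (star (N i j) * (Uᴴ * W) i j).re * (x i - y j) := by
    have : trace ((U * N * Wᴴ)ᴴ * (X - Y)) = trace ((diagonal (fun i => (x i : ℂ)) * (Uᴴ * W) -
        (Uᴴ * W) * diagonal (fun i => (y i : ℂ))) * Nᴴ) := by
      have hX : diagonal (fun i => (x i : ℂ)) * (Uᴴ * W) = Uᴴ * X * W := by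
        rw [h.2.2]
        simp only [← Matrix.mul_assoc, h.1, Matrix.one_mul]
      have hY : (Uᴴ * W) * diagonal (fun i => (y i : ℂ)) = Uᴴ * Y * W := by
        rw [h'.2.2]
        simp only [Matrix.mul_assoc, h'.1, Matrix.mul_one]
      rw [hX, hY, ← Matrix.sub_mul, ← Matrix.mul_sub, Matrix.trace_mul_comm _ Nᴴ]
      simp only [conjTranspose_mul, conjTranspose_conjTranspose]
      rw [Matrix.mul_assoc, Matrix.trace_mul_comm W]
      simp only [Matrix.mul_assoc]
    rw [this, trace, Complex.re_sum]
    refine sum_congr rfl fun i _ => ?_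
    rw [diag_apply, mul_apply, Complex.re_sum]
    refine sum_congr rfl fun j _ => ?_
    rw [Matrix.sub_apply, diagonal_mul, mul_diagonal, conjTranspose_apply]
    simp
    ring
  have e2 : (trace ((U * N * Wᴴ)ᴴ * X * (U * N * Wᴴ))).re =
      ∑ i, ∑ j, x i * Complex.normSq (N i j) := by
    have : trace ((U * N * Wᴴ)ᴴ * X * (U * N * Wᴴ)) =
        trace (diagonal (fun i => (x i : ℂ)) * N * Nᴴ) := by
      rw [h.2.2]
      calc _ = trace (W * (Nᴴ * (Uᴴ * U) * diagonal (fun i => (x i : ℂ)) * (Uᴴ * U) * N * Wᴴ)) := by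
            simp [Matrix.mul_assoc]
        _ = trace (Nᴴ * (diagonal (fun i => (x i : ℂ)) * N)) := by
            rw [Matrix.trace_mul_comm]
            simp only [h.1, Matrix.mul_assoc, h'.1, Matrix.mul_one]
        _ = _ := by rw [Matrix.trace_mul_comm]
    rw [this, trace, Complex.re_sum]
    refine sum_congr rfl fun i _ => ?_
    rw [diag_apply, mul_apply, Complex.re_sum]
    refine sum_congr rfl fun j _ => ?_
    rw [diagonal_mul, conjTranspose_apply]
    simp [Complex.normSq_apply]
    ring
  have e3 : (trace ((U * N * Wᴴ) * Y * (U * N * Wᴴ)ᴴ)).re =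
      ∑ i, ∑ j, y j * Complex.normSq (N i j) := by
    have : trace ((U * N * Wᴴ) * Y * (U * N * Wᴴ)ᴴ) =
        trace (N * diagonal (fun i => (y i : ℂ)) * Nᴴ) := by
      rw [h'.2.2]
      calc _ = trace (U * (N * (Wᴴ * W) * diagonal (fun i => (y i : ℂ)) * (Wᴴ * W) * Nᴴ * Uᴴ)) := by
            simp [Matrix.mul_assoc]
        _ = _ := by
            rw [Matrix.trace_mul_comm]
            simp only [h.1, Matrix.mul_assoc, h'.1, Matrix.mul_one]
    rw [this, trace, Complex.re_sum]
    refine sum_congr rfl fun i _ => ?_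
    rw [diag_apply, mul_apply, Complex.re_sum]
    refine sum_congr rfl fun j _ => ?_
    rw [mul_diagonal, conjTranspose_apply]
    simp [Complex.normSq_apply]
    ring
  rw [quadFunctional, e1, e2, e3]
  simp only [mul_sum, ← sum_sub_distrib]
  refine sum_congr rfl fun i _ => sum_congr rfl fun j _ => ?_
  ring

/-- The integrand of the integral representation of the relative entropy, computed from
diagonalizations. -/
noncomputable def quadSup {d : ℕ} (s : ℝ) (U W : Matrix (Fin d) (Fin d) ℂ) (x y : Fin d → ℝ) : ℝ :=
  ∑ i, ∑ j, Complex.normSq ((Uᴴ * W) i j) * ((x i - y j) ^ 2 / (s * x i + (1 - s) * y j))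

lemma quadFunctional_le {d : ℕ} {X Y U W : Matrix (Fin d) (Fin d) ℂ} {x y : Fin d → ℝ}
    (h : IsSpectralDecomp X U x) (h' : IsSpectralDecomp Y W y) (hx : ∀ i, 0 ≤ x i)
    (hy : ∀ i, 0 ≤ y i) {s : ℝ} (hs : s ∈ Set.Ioo (0 : ℝ) 1) (Z : Matrix (Fin d) (Fin d) ℂ) :
    quadFunctional s Z X Y ≤ quadSup s U W x y := by
  have hZ : Z = U * (Uᴴ * Z * W) * Wᴴ := by
    calc Z = (U * Uᴴ) * Z * (W * Wᴴ) := by simp [h.2.1, h'.2.1]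
      _ = _ := by simp only [Matrix.mul_assoc]
  rw [hZ, quadFunctional_eq h h', quadSup]
  refine sum_le_sum fun i _ => sum_le_sum fun j _ => ?_
  generalize (Uᴴ * Z * W) i j = n
  generalize (Uᴴ * W) i j = m
  have h1 : 0 < 1 - s := sub_pos.2 hs.2
  have h2 := mul_nonneg hs.1.le (hx i)
  have h3 := mul_nonneg h1.le (hy j)
  rcases (add_nonneg h2 h3).eq_or_lt with h0 | h0
  · have hx0 : x i = 0 := by
      have : s * x i = 0 := by linarith
      exact (mul_eq_zero.mp this).resolve_left hs.1.ne'
    have hy0 : y j = 0 := by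
      have : (1 - s) * y j = 0 := by linarith
      exact (mul_eq_zero.mp this).resolve_left h1.ne'
    simp [hx0, hy0]
  · rw [← mul_div_assoc, le_div_iff₀ h0]
    generalize s * x i + (1 - s) * y j = D at *
    simp only [Complex.normSq_apply, RCLike.star_def, Complex.mul_re, Complex.conj_re,
      Complex.conj_im]
    nlinarith [sq_nonneg ((x i - y j) * m.re - D * n.re), sq_nonneg ((x i - y j) * m.im - D * n.im)]

lemma exists_quadFunctional_eq {d : ℕ} {X Y U W : Matrix (Fin d) (Fin d) ℂ} {x y : Fin d → ℝ}
    (h : IsSpectralDecomp X U x) (h' : IsSpectralDecomp Y W y) (s : ℝ) :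
    ∃ Z, quadFunctional s Z X Y = quadSup s U W x y := by
  refine ⟨U * (Matrix.of fun i j =>
    (((x i - y j) / (s * x i + (1 - s) * y j) : ℝ) : ℂ) * (Uᴴ * W) i j) * Wᴴ, ?_⟩
  rw [quadFunctional_eq h h', quadSup]
  refine sum_congr rfl fun i _ => sum_congr rfl fun j _ => ?_
  rw [Matrix.of_apply]
  generalize (Uᴴ * W) i j = m
  generalize s * x i + (1 - s) * y j = D
  generalize x i - y j = r
  rw [Complex.normSq_mul, Complex.normSq_ofReal, star_mul']
  have : (star ((r / D : ℝ) : ℂ) * star m * m).re = r / D * Complex.normSq m := by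
    simp only [RCLike.star_def, Complex.conj_ofReal, mul_assoc]
    rw [← Complex.normSq_eq_conj_mul_self, ← Complex.ofReal_mul, Complex.ofReal_re]
  rw [this]
  rcases eq_or_ne D 0 with rfl | hD
  · simp
  · field_simp
    ring

lemma IsSpectralDecomp.integral_quadSup {d : ℕ} {X Y U W : Matrix (Fin d) (Fin d) ℂ}
    {x y : Fin d → ℝ} (h : IsSpectralDecomp X U x) (h' : IsSpectralDecomp Y W y)
    (hx : ∀ i, 0 ≤ x i) (hy : ∀ i, 0 ≤ y i) (hker : ∀ v, Y *ᵥ v = 0 → X *ᵥ v = 0) :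
    IntervalIntegrable (fun s => (1 - s) * quadSup s U W x y) MeasureTheory.volume 0 1 ∧
    ∫ s in (0 : ℝ)..1, (1 - s) * quadSup s U W x y =
      qRelEntropy X Y - (trace X).re + (trace Y).re := by
  have H := fun i j => intervalIntegral_relEntropy (Complex.normSq_nonneg ((Uᴴ * W) i j)) (hx i)
    (hy j) (h.normSq_mul_eq_zero h' hker i j)
  have hfun : (fun s => (1 - s) * quadSup s U W x y) = fun s => ∑ i, ∑ j,
      Complex.normSq ((Uᴴ * W) i j) *
        ((1 - s) * ((x i - y j) ^ 2 / (s * x i + (1 - s) * y j))) := by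
    ext s
    rw [quadSup, mul_sum]
    refine sum_congr rfl fun i _ => ?_
    rw [mul_sum]
    exact sum_congr rfl fun j _ => by ring
  have hint : ∀ i, IntervalIntegrable (fun s => ∑ j, Complex.normSq ((Uᴴ * W) i j) *
        ((1 - s) * ((x i - y j) ^ 2 / (s * x i + (1 - s) * y j)))) MeasureTheory.volume 0 1 := by
    intro i
    have := IntervalIntegrable.sum univ fun j _ => (H i j).1
    simpa only [Finset.sum_fn] using this
  rw [hfun]
  refine ⟨?_, ?_⟩
  · have := IntervalIntegrable.sum univ fun i _ => hint i
    simpa only [Finset.sum_fn] using this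
  · rw [intervalIntegral.integral_finsetSum fun i _ => hint i, h.qRelEntropy_eq h',
      h.trace_left h'.2.1, h'.trace_right h.2.1, ← sum_sub_distrib, ← sum_add_distrib]
    refine sum_congr rfl fun i _ => ?_
    rw [intervalIntegral.integral_finsetSum fun j _ => (H i j).1, ← sum_sub_distrib,
      ← sum_add_distrib]
    refine sum_congr rfl fun j _ => ?_
    rw [(H i j).2]
    ring

lemma ker_mono_of_sum {d : ℕ} {ι : Type*} {t : Finset ι}
    {X : ι → Matrix (Fin d) (Fin d) ℂ} (hX : ∀ i ∈ t, (X i).PosSemidef) {v : Fin d → ℂ}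
    (hv : (∑ i ∈ t, X i) *ᵥ v = 0) : ∀ i ∈ t, X i *ᵥ v = 0 := by
  have h0 : ∑ i ∈ t, star v ⬝ᵥ (X i *ᵥ v) = 0 := by
    rw [← dotProduct_sum, ← Matrix.sum_mulVec, hv, dotProduct_zero]
  intro i hi
  rw [← (hX i hi).dotProduct_mulVec_zero_iff]
  exact (sum_eq_zero_iff_of_nonneg fun i hi => (hX i hi).dotProduct_mulVec_nonneg v).mp h0 i hi

/-- Joint subadditivity of the quantum relative entropy on positive semidefinite matrices. -/
theorem qRelEntropy_sum_le {d : ℕ} {ι : Type*} (t : Finset ι)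
    (X Y : ι → Matrix (Fin d) (Fin d) ℂ) (hX : ∀ i, (X i).PosSemidef)
    (hY : ∀ i, (Y i).PosSemidef) (hker : ∀ i, ∀ v, Y i *ᵥ v = 0 → X i *ᵥ v = 0) :
    qRelEntropy (∑ i ∈ t, X i) (∑ i ∈ t, Y i) ≤ ∑ i ∈ t, qRelEntropy (X i) (Y i) := by
  choose U x hU hx using fun i => (hX i).exists_isSpectralDecomp
  choose W y hW hy using fun i => (hY i).exists_isSpectralDecomp
  obtain ⟨U₀, x₀, hU₀, hx₀⟩ := (posSemidef_sum t fun i _ => hX i).exists_isSpectralDecomp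
  obtain ⟨W₀, y₀, hW₀, hy₀⟩ := (posSemidef_sum t fun i _ => hY i).exists_isSpectralDecomp
  have hker₀ : ∀ v, (∑ i ∈ t, Y i) *ᵥ v = 0 → (∑ i ∈ t, X i) *ᵥ v = 0 := fun v hv => by
    rw [Matrix.sum_mulVec]
    exact sum_eq_zero fun i hi => hker i v (ker_mono_of_sum (fun i _ => hY i) hv i hi)
  have I₀ := hU₀.integral_quadSup hW₀ hx₀ hy₀ hker₀
  have I := fun i => (hU i).integral_quadSup (hW i) (hx i) (hy i) (hker i)
  have hle : ∫ s in (0 : ℝ)..1, (1 - s) * quadSup s U₀ W₀ x₀ y₀ ≤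
      ∫ s in (0 : ℝ)..1, ∑ i ∈ t, (1 - s) * quadSup s (U i) (W i) (x i) (y i) := by
    refine intervalIntegral.integral_mono_on_of_le_Ioo zero_le_one I₀.1 ?_ fun s hs => ?_
    · have := IntervalIntegrable.sum t fun i _ => (I i).1
      simpa only [Finset.sum_fn] using this
    · obtain ⟨Z, hZ⟩ := exists_quadFunctional_eq hU₀ hW₀ s
      rw [← hZ, quadFunctional_sum, ← mul_sum]
      exact mul_le_mul_of_nonneg_left (sum_le_sum fun i _ =>
        quadFunctional_le (hU i) (hW i) (hx i) (hy i) hs Z) (sub_nonneg.2 hs.2.le)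
  rw [I₀.2, intervalIntegral.integral_finsetSum fun i _ => (I i).1,
    sum_congr rfl fun i _ => (I i).2] at hle
  simp only [trace_sum, Complex.re_sum, sum_add_distrib, sum_sub_distrib] at hle
  linarith

section Instrument

variable {d : ℕ} {Ω K : Type*} [Fintype K] (V : Ω → K → Matrix (Fin d) (Fin d) ℂ)

lemma instrOp_posSemidef {ρ : Matrix (Fin d) (Fin d) ℂ} (hρ : ρ.PosSemidef) (ω : Ω) :
    (instrOp V ω ρ).PosSemidef :=
  posSemidef_sum _ fun _ _ => hρ.mul_mul_conjTranspose_same _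

lemma trace_instrOp (ρ : Matrix (Fin d) (Fin d) ℂ) (ω : Ω) :
    (trace (instrOp V ω ρ)).re = outcomeProb V ρ ω := by
  simp only [instrOp, outcomeProb, instrPOV, trace_sum, Matrix.sum_mul]
  congr 1
  refine sum_congr rfl fun k _ => ?_
  rw [Matrix.trace_mul_comm, Matrix.mul_assoc]

lemma outcomeProb_nonneg {ρ : Matrix (Fin d) (Fin d) ℂ} (hρ : ρ.PosSemidef) (ω : Ω) :
    0 ≤ outcomeProb V ρ ω := by
  rw [← trace_instrOp]
  exact (Complex.nonneg_iff.mp (instrOp_posSemidef V hρ ω).trace_nonneg).1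

lemma instrOp_eq_zero {ρ : Matrix (Fin d) (Fin d) ℂ} (hρ : ρ.PosSemidef) {ω : Ω}
    (h : outcomeProb V ρ ω = 0) : instrOp V ω ρ = 0 := by
  have hO := instrOp_posSemidef V hρ ω
  refine hO.trace_eq_zero_iff.mp (Complex.ext ?_ ?_)
  · rw [trace_instrOp, h, Complex.zero_re]
  · exact (Complex.nonneg_iff.mp hO.trace_nonneg).2.symm

lemma outcomeProb_smul_postState {ρ : Matrix (Fin d) (Fin d) ℂ} (hρ : ρ.PosSemidef) (ω : Ω) :
    outcomeProb V ρ ω • postState V ρ ω = instrOp V ω ρ := by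
  by_cases h : outcomeProb V ρ ω = 0
  · rw [h, zero_smul, instrOp_eq_zero V hρ h]
  · exact smul_inv_smul₀ h _

lemma instrOp_sum_smul {A : Type*} [Fintype A] (p : A → ℝ) (ρ : A → Matrix (Fin d) (Fin d) ℂ)
    (ω : Ω) : instrOp V ω (∑ α, p α • ρ α) = ∑ α, p α • instrOp V ω (ρ α) := by
  simp only [instrOp, Matrix.mul_sum, Matrix.sum_mul, smul_sum, Matrix.mul_smul, Matrix.smul_mul]
  exact sum_comm

lemma outcomeProb_sum_smul {A : Type*} [Fintype A] (p : A → ℝ)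
    (ρ : A → Matrix (Fin d) (Fin d) ℂ) (ω : Ω) :
    outcomeProb V (∑ α, p α • ρ α) ω = ∑ α, p α * outcomeProb V (ρ α) ω := by
  simp only [← trace_instrOp, instrOp_sum_smul, trace_sum, Complex.re_sum, trace_smul,
    Complex.smul_re, smul_eq_mul]

variable [Fintype Ω]

lemma chiQuantity_postState {ρ : Matrix (Fin d) (Fin d) ℂ} (hρ : ρ.PosSemidef) :
    chiQuantity (outcomeProb V ρ) (postState V ρ) =
      ∑ ω ∈ univ.filter (fun ω => 0 < outcomeProb V ρ ω),
        outcomeProb V ρ ω * qRelEntropy (postState V ρ ω) (∑ ω, instrOp V ω ρ) := by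
  simp only [chiQuantity, outcomeProb_smul_postState V hρ]

/-- Rescaling of the relative entropy of an a posteriori state with respect to the average
a posteriori state. -/
lemma qRelEntropy_smul_instrOp {ρ : Matrix (Fin d) (Fin d) ℂ} (hρ : ρ.PosSemidef) {ω : Ω}
    (hω : 0 < outcomeProb V ρ ω) {c b : ℝ} (hc : 0 < c) (hb : 0 < b) :
    qRelEntropy (c • instrOp V ω ρ) (b • ∑ ω, instrOp V ω ρ) =
      c * outcomeProb V ρ ω * (qRelEntropy (postState V ρ ω) (∑ ω, instrOp V ω ρ) +
        Real.log (c * outcomeProb V ρ ω / b)) := by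
  have hO := fun ω => instrOp_posSemidef V hρ ω
  have htr : (trace (postState V ρ ω)).re = 1 := by
    rw [postState, trace_smul, Complex.smul_re, trace_instrOp, smul_eq_mul,
      inv_mul_cancel₀ hω.ne']
  have hpost : (postState V ρ ω).PosSemidef := (hO ω).smul (inv_nonneg.2 hω.le)
  have hker : ∀ v, (∑ ω, instrOp V ω ρ) *ᵥ v = 0 → postState V ρ ω *ᵥ v = 0 := fun v hv => by
    rw [postState, Matrix.smul_mulVec, ker_mono_of_sum (fun ω _ => hO ω) hv ω (mem_univ ω),
      smul_zero]
  have := qRelEntropy_smul_smul hpost (posSemidef_sum univ fun ω _ => hO ω) hker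
    (mul_pos hc hω) hb
  rw [htr, mul_one, mul_smul, outcomeProb_smul_postState V hρ] at this
  exact this

lemma qRelEntropy_instrOp_le {A : Type*} [Fintype A] {p : A → ℝ} (hp : ∀ α, 0 ≤ p α)
    {ρ : A → Matrix (Fin d) (Fin d) ℂ} (hρ : ∀ α, (ρ α).PosSemidef) (ω : Ω) {b : ℝ} (hb : 0 < b) :
    qRelEntropy (instrOp V ω (∑ α, p α • ρ α)) (b • ∑ ω, instrOp V ω (∑ α, p α • ρ α)) ≤
      ∑ α, qRelEntropy (p α • instrOp V ω (ρ α)) ((p α * b) • ∑ ω, instrOp V ω (ρ α)) := by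
  have hO := fun ω α => instrOp_posSemidef V (hρ α) ω
  have hY : b • ∑ ω, instrOp V ω (∑ α, p α • ρ α) =
      ∑ α, (p α * b) • ∑ ω, instrOp V ω (ρ α) := by
    simp only [instrOp_sum_smul, smul_sum, smul_smul, mul_comm b]
    exact sum_comm
  rw [hY, instrOp_sum_smul]
  refine qRelEntropy_sum_le univ _ _ (fun α => (hO ω α).smul (hp α))
    (fun α => (posSemidef_sum univ fun ω _ => hO ω α).smul (mul_nonneg (hp α) hb.le)) ?_
  intro α v hv
  rcases (hp α).eq_or_lt with h0 | h0
  · rw [← h0, zero_smul, zero_mulVec]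
  · rw [Matrix.smul_mulVec] at hv ⊢
    have := (smul_eq_zero.mp hv).resolve_left (mul_pos h0 hb).ne'
    rw [ker_mono_of_sum (fun ω _ => hO ω α) this ω (mem_univ ω), smul_zero]

end Instrument

/-- variant post-measurement χ-quantity bound. -/
theorem postmeasurement_chi_bound {d : ℕ} (hd : 1 ≤ d)
    {A Ω K : Type*} [Fintype A] [Fintype Ω] [Fintype K]
    (p : A → ℝ) (hp : ∀ α, 0 ≤ p α) (hp1 : ∑ α, p α = 1)
    (ρ : A → Matrix (Fin d) (Fin d) ℂ)
    (hρ : ∀ α, (ρ α).PosSemidef) (hρtr : ∀ α, (ρ α).trace = 1)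
    (V : Ω → K → Matrix (Fin d) (Fin d) ℂ)
    (hV : ∑ ω, instrPOV V ω = 1) :
    let η := ∑ α, p α • ρ α
    let pf := fun ω => outcomeProb V η ω
    let pfi := fun ω α => outcomeProb V (ρ α) ω
    let ρf := fun α ω => (pfi ω α)⁻¹ • instrOp V ω (ρ α)
    let ρfbar := fun ω => (pf ω)⁻¹ • instrOp V ω η
    mutualInfo p ρ (instrPOV V) +
        ∑ α ∈ Finset.univ.filter (fun α => 0 < p α),
          p α * chiQuantity (fun ω => pfi ω α) (fun ω => ρf α ω) ≥
      chiQuantity pf ρfbar := by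
  intro η pf pfi ρf ρfbar
  have hη : η.PosSemidef := posSemidef_sum univ fun α _ => (hρ α).smul (hp α)
  have hpfi : ∀ ω α, 0 ≤ pfi ω α := fun ω α => outcomeProb_nonneg V (hρ α) ω
  have hpf : ∀ ω, pf ω = ∑ α, p α * pfi ω α := outcomeProb_sum_smul V p ρ
  have hR : chiQuantity pf ρfbar = ∑ ω, if 0 < pf ω then
      pf ω * qRelEntropy (postState V η ω) (∑ ω, instrOp V ω η) else 0 := by
    rw [← sum_filter]
    exact chiQuantity_postState V hη
  have hχ : ∀ α, chiQuantity (fun ω => pfi ω α) (fun ω => ρf α ω) = ∑ ω, if 0 < pfi ω α then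
      pfi ω α * qRelEntropy (postState V (ρ α) ω) (∑ ω, instrOp V ω (ρ α)) else 0 := fun α => by
    rw [← sum_filter]
    exact chiQuantity_postState V (hρ α)
  have hI : mutualInfo p ρ (instrPOV V) = ∑ ω, ∑ α, if 0 < p α * pfi ω α then
      p α * pfi ω α * Real.log (p α * pfi ω α / (p α * pf ω)) else 0 := by
    rw [mutualInfo, sum_filter, Fintype.sum_prod_type, sum_comm]
    rfl
  rw [ge_iff_le, hR, hI, sum_filter]
  simp only [hχ, mul_sum, ← sum_filter (fun α => 0 < p α)]
  rw [sum_comm (s := univ.filter _), ← sum_add_distrib]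
  refine sum_le_sum fun ω _ => ?_
  rw [sum_filter, ← sum_add_distrib]
  split_ifs with hω
  · have hle := qRelEntropy_instrOp_le V hp hρ ω hω
    have hl := qRelEntropy_smul_instrOp V hη hω one_pos hω
    rw [one_smul, one_mul, div_self (ne_of_gt hω), Real.log_one, add_zero] at hl
    refine hl.ge.trans (hle.trans (sum_le_sum fun α _ => ?_))
    rcases (hp α).eq_or_lt with h0 | h0
    · simp [← h0, qRelEntropy]
    rcases (hpfi ω α).eq_or_lt with h1 | h1
    · simp [← h1, instrOp_eq_zero V (hρ α) h1.symm, qRelEntropy]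
    rw [if_pos (mul_pos h0 h1), if_pos h0, if_pos h1,
      qRelEntropy_smul_instrOp V (hρ α) h1 h0 (mul_pos h0 hω)]
    exact le_of_eq (by ring)
  · have h0 : ∀ α, p α * pfi ω α = 0 := fun α =>
      (sum_eq_zero_iff_of_nonneg fun α _ => mul_nonneg (hp α) (hpfi ω α)).mp
        (le_antisymm ((hpf ω).ge.trans (not_lt.mp hω))
          (sum_nonneg fun α _ => mul_nonneg (hp α) (hpfi ω α))) α (mem_univ α)
    refine sum_nonneg fun α _ => ?_
    rw [h0, if_neg (lt_irrefl _), zero_add]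
    split_ifs with h1 h2
    · exact absurd (h0 α) (mul_pos h1 h2).ne'
    · simp
    · rfl
end

section
/- (Scutaru's bound.) Let {p_i, ρ_i} be an ensemble of letter states on a finite alphabet A with positive definite average state η_i, and let E be a POV measure with finite outcome set Ω. Define ε(ω) = Σ_α p_{i|f}(α|ω) ρ_i(α) for p_f(ω) > 0. Then I_c{p_i, ρ_i; E} ≥ χ{p_f, ε}, and the ensemble {p_f, ε} has average state Σ_ω p_f(ω) ε(ω) = η_i. -/
open Matrix Finset
open scoped BigOperators ComplexOrder

open Topology Filter

/-- `∫₀ᵀ a² / (b + t a) dt = a (log (b + T a) - log b)`, in differential form. -/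
lemma hasDerivAt_mul_log_add {a b t : ℝ} (ha : 0 ≤ a) (hb : a = 0 ∨ 0 < b) (ht : 0 ≤ t) :
    HasDerivAt (fun s => a * (Real.log (b + s * a) - Real.log b)) (a ^ 2 / (b + t * a)) t := by
  rcases hb with rfl | hb
  · simpa using hasDerivAt_const t (0 : ℝ)
  · have hpos : b + t * a ≠ 0 := by positivity
    have h1 : HasDerivAt (fun s => b + s * a) a t := by
      simpa using ((hasDerivAt_id t).mul_const a).const_add b
    have h2 : a ^ 2 / (b + t * a) = a * (a / (b + t * a)) := by ring
    rw [h2]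
    exact ((h1.log hpos).sub_const (Real.log b)).const_mul a

lemma tendsto_mul_log_add_sub_log {a b : ℝ} (ha : 0 ≤ a) :
    Tendsto (fun T => a * (Real.log (b + T * a) - Real.log b) - a * Real.log T) atTop
      (𝓝 (a * (Real.log a - Real.log b))) := by
  rcases ha.eq_or_lt with rfl | ha
  · simp
  · have h1 : Tendsto (fun T : ℝ => b * T⁻¹ + a) atTop (𝓝 (b * 0 + a)) :=
      (tendsto_inv_atTop_zero.const_mul b).add_const a
    have h2 : Tendsto (fun T : ℝ => a * (Real.log (b * T⁻¹ + a) - Real.log b)) atTop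
        (𝓝 (a * (Real.log a - Real.log b))) := by
      rw [mul_zero, zero_add] at h1
      exact ((h1.log ha.ne').sub_const _).const_mul a
    have h3 : ∀ᶠ T : ℝ in atTop, 0 < b + T * a :=
      (tendsto_atTop_add_const_left _ b (tendsto_id.atTop_mul_const ha)).eventually_gt_atTop 0
    refine h2.congr' ?_
    filter_upwards [eventually_gt_atTop 0, h3] with T hT hpos
    have : b * T⁻¹ + a = (b + T * a) / T := by field_simp
    rw [this, Real.log_div hpos.ne' hT.ne']
    ring

/-- Comparison of `∑ a log (a / b)` for two weighted families from the comparison of the kernels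
`∑ a² / (b + t a)` in the integral representation of the logarithm. -/
lemma sum_mul_log_sub_log_le {I J : Type*} [Fintype I] [Fintype J]
    (w a b : I → ℝ) (q p : J → ℝ)
    (ha : ∀ i, 0 ≤ a i) (hb : ∀ i, a i = 0 ∨ 0 < b i)
    (hq : ∀ j, 0 ≤ q j) (hp : ∀ j, q j = 0 ∨ 0 < p j)
    (hsum : ∑ i, w i * a i = ∑ j, q j)
    (h : ∀ t, 0 ≤ t →
      ∑ i, w i * (a i ^ 2 / (b i + t * a i)) ≤ ∑ j, q j ^ 2 / (p j + t * q j)) :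
    ∑ i, w i * (a i * (Real.log (a i) - Real.log (b i))) ≤
      ∑ j, q j * (Real.log (q j) - Real.log (p j)) := by
  set L : ℝ → ℝ := fun T => ∑ i, w i * (a i * (Real.log (b i + T * a i) - Real.log (b i)))
  set R : ℝ → ℝ := fun T => ∑ j, q j * (Real.log (p j + T * q j) - Real.log (p j))
  have hL : ∀ t, 0 ≤ t → HasDerivAt L (∑ i, w i * (a i ^ 2 / (b i + t * a i))) t := fun t ht =>
    HasDerivAt.fun_sum fun i _ => (hasDerivAt_mul_log_add (ha i) (hb i) ht).const_mul (w i)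
  have hR : ∀ t, 0 ≤ t → HasDerivAt R (∑ j, q j ^ 2 / (p j + t * q j)) t := fun t ht =>
    HasDerivAt.fun_sum fun j _ => hasDerivAt_mul_log_add (hq j) (hp j) ht
  have hmono : MonotoneOn (fun T => R T - L T) (Set.Ici 0) := by
    refine monotoneOn_of_hasDerivWithinAt_nonneg (convex_Ici 0)
      (fun t ht => ((hR t ht).sub (hL t ht)).continuousAt.continuousWithinAt)
      (fun t ht => ((hR t (interior_subset ht)).sub (hL t (interior_subset ht))).hasDerivWithinAt)
      (fun t ht => sub_nonneg.2 (h t (interior_subset ht)))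
  have hLR : ∀ T, 0 ≤ T → L T ≤ R T := fun T hT => by
    have := hmono (Set.mem_Ici.2 le_rfl) (Set.mem_Ici.2 hT) hT
    simpa [L, R] using this
  have hLlim := tendsto_finsetSum univ fun i _ =>
    (tendsto_mul_log_add_sub_log (b := b i) (ha i)).const_mul (w i)
  have hRlim := tendsto_finsetSum univ fun j _ => tendsto_mul_log_add_sub_log (b := p j) (hq j)
  refine le_of_tendsto_of_tendsto hLlim hRlim ?_
  filter_upwards [eventually_ge_atTop 0] with T hT
  have e1 : ∑ i, w i * (a i * (Real.log (b i + T * a i) - Real.log (b i)) - a i * Real.log T)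
      = L T - (∑ i, w i * a i) * Real.log T := by
    simp only [L, Finset.sum_mul, ← Finset.sum_sub_distrib]
    exact Finset.sum_congr rfl fun i _ => by ring
  have e2 : ∑ j, (q j * (Real.log (p j + T * q j) - Real.log (p j)) - q j * Real.log T)
      = R T - (∑ j, q j) * Real.log T := by
    simp only [R, Finset.sum_mul, ← Finset.sum_sub_distrib]
  rw [e1, e2, hsum]
  linarith [hLR T hT]

section MatrixKernel

variable {n : Type*} [Fintype n]

lemma re_trace_mul_conjTranspose {A : Matrix n n ℂ} (hA : A.IsHermitian) (X : Matrix n n ℂ) :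
    (A * Xᴴ).trace.re = (A * X).trace.re := by
  have h : (A * Xᴴ).trace = star (A * X).trace := by
    rw [← trace_conjTranspose, conjTranspose_mul, hA.eq, trace_mul_comm]
  rw [h, Complex.star_def, Complex.conj_re]

variable [DecidableEq n]

lemma trace_diagonal_mul_mul_diagonal_mul_conjTranspose (x y : n → ℝ) (M : Matrix n n ℂ) :
    (diagonal (fun i => (x i : ℂ)) * M * diagonal (fun j => (y j : ℂ)) * Mᴴ).trace =
      ((∑ i, ∑ j, x i * ‖M i j‖ ^ 2 * y j : ℝ) : ℂ) := by
  simp only [trace, diag_apply, mul_apply (N := Mᴴ), mul_diagonal, diagonal_mul,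
    conjTranspose_apply]
  push_cast
  refine Finset.sum_congr rfl fun i _ => Finset.sum_congr rfl fun j _ => ?_
  rw [← Complex.mul_conj', Complex.star_def]
  ring

/-- `2 x Re Tr(ρ X) - x² ≤ Tr(X ρ X†)` for a state `ρ` and real `x`. -/
lemma two_mul_re_trace_sub_sq_le {ρ : Matrix n n ℂ} (hρ : ρ.PosSemidef) (htr : ρ.trace = 1)
    (X : Matrix n n ℂ) (x : ℝ) :
    2 * x * (ρ * X).trace.re - x ^ 2 ≤ (X * ρ * Xᴴ).trace.re := by
  have h := (Complex.nonneg_iff.1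
    (hρ.mul_mul_conjTranspose_same (X - (x : ℂ) • 1)).trace_nonneg).1
  have h1 := re_trace_mul_conjTranspose hρ.isHermitian X
  simp only [conjTranspose_sub, conjTranspose_smul, conjTranspose_one, Matrix.sub_mul,
    Matrix.mul_sub, Matrix.smul_mul, Matrix.mul_smul, Matrix.one_mul, Matrix.mul_one, trace_sub,
    trace_smul, trace_mul_comm X ρ, htr, Complex.star_def, Complex.conj_ofReal, smul_eq_mul,
    Complex.sub_re, Complex.re_ofReal_mul, Complex.one_re, h1] at h
  linarith

/-- The variational expression behind the joint convexity of the relative entropy kernel, evaluated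
on the pair `q ρ`, `p ρ`. -/
lemma two_mul_re_trace_sub_le {ρ : Matrix n n ℂ} (hρ : ρ.PosSemidef) (htr : ρ.trace = 1)
    (X : Matrix n n ℂ) {p q t : ℝ} (hp : 0 ≤ p) (hq : 0 ≤ q) (ht : 0 ≤ t)
    (hqp : q = 0 ∨ 0 < p) :
    2 * q * (ρ * X).trace.re - p * (X * ρ * Xᴴ).trace.re - t * q * (Xᴴ * ρ * X).trace.re ≤
      q ^ 2 / (p + t * q) := by
  set x := q / (p + t * q) with hx
  have h1 := mul_le_mul_of_nonneg_left (two_mul_re_trace_sub_sq_le hρ htr X x) hp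
  have h2 := mul_le_mul_of_nonneg_left (two_mul_re_trace_sub_sq_le hρ htr Xᴴ x) (mul_nonneg ht hq)
  rw [re_trace_mul_conjTranspose hρ.isHermitian, conjTranspose_conjTranspose] at h2
  have h4 : (p + t * q) * x = q := by
    rcases hqp with rfl | hp
    · simp [hx]
    · rw [hx]; field_simp
  have h5 : q ^ 2 / (p + t * q) = q * x := by rw [hx]; ring
  rw [h5]
  have h6 : (p + t * q) * (2 * x * (ρ * X).trace.re - x ^ 2) = 2 * q * (ρ * X).trace.re - q * x := by
    linear_combination (2 * (ρ * X).trace.re - x) * h4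
  linarith

lemma re_trace_sum_smul_mul {ι : Type*} [Fintype ι] (r : ι → ℝ) (ρ : ι → Matrix n n ℂ)
    (X Y : Matrix n n ℂ) :
    (X * (∑ α, r α • ρ α) * Y).trace.re = ∑ α, r α * (X * ρ α * Y).trace.re := by
  simp [Finset.mul_sum, Finset.sum_mul, trace_sum]

lemma IsHermitian.eq_eigenvectorUnitary_mul {A : Matrix n n ℂ} (hA : A.IsHermitian) :
    A = (hA.eigenvectorUnitary : Matrix n n ℂ) *
      diagonal (fun i => (hA.eigenvalues i : ℂ)) * (hA.eigenvectorUnitary : Matrix n n ℂ)ᴴ := by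
  conv_lhs => rw [hA.spectral_theorem]
  rfl

/-- The kernel `∑ ‖⟨aᵢ, bⱼ⟩‖² aᵢ² / (bⱼ + t aᵢ)` of a pair of mixtures of the same states is at most
the kernel of the mixing weights. -/
lemma sum_kernel_eigenvalues_le {ι : Type*} [Fintype ι] (p q : ι → ℝ)
    (hp : ∀ α, 0 ≤ p α) (hq : ∀ α, 0 ≤ q α) (hqp : ∀ α, q α = 0 ∨ 0 < p α)
    (ρ : ι → Matrix n n ℂ) (hρ : ∀ α, (ρ α).PosSemidef) (hρtr : ∀ α, (ρ α).trace = 1)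
    (hA : (∑ α, q α • ρ α).PosSemidef) (hB : (∑ α, p α • ρ α).PosDef) {t : ℝ} (ht : 0 ≤ t) :
    ∑ x : n × n, ‖((hA.isHermitian.eigenvectorUnitary : Matrix n n ℂ)ᴴ *
        (hB.isHermitian.eigenvectorUnitary : Matrix n n ℂ)) x.1 x.2‖ ^ 2 *
        (hA.isHermitian.eigenvalues x.1 ^ 2 /
          (hB.isHermitian.eigenvalues x.2 + t * hA.isHermitian.eigenvalues x.1)) ≤
      ∑ α, q α ^ 2 / (p α + t * q α) := by
  set U : Matrix n n ℂ := hA.isHermitian.eigenvectorUnitary.1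
  set V : Matrix n n ℂ := hB.isHermitian.eigenvectorUnitary.1
  set a := hA.isHermitian.eigenvalues
  set b := hB.isHermitian.eigenvalues
  have ha : ∀ i, 0 ≤ a i := hA.eigenvalues_nonneg
  have hb : ∀ j, 0 < b j := hB.eigenvalues_pos
  have hUU : Uᴴ * U = 1 := Unitary.coe_star_mul_self hA.isHermitian.eigenvectorUnitary
  have hVV : Vᴴ * V = 1 := Unitary.coe_star_mul_self hB.isHermitian.eigenvectorUnitary
  have hAeq : (∑ α, q α • ρ α) = U * diagonal (fun i => (a i : ℂ)) * Uᴴ :=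
    IsHermitian.eq_eigenvectorUnitary_mul hA.isHermitian
  have hBeq : (∑ α, p α • ρ α) = V * diagonal (fun i => (b i : ℂ)) * Vᴴ :=
    IsHermitian.eq_eigenvectorUnitary_mul hB.isHermitian
  set M := Uᴴ * V with hM
  set Y : Matrix n n ℂ := of fun i j => ((a i / (b j + t * a i) : ℝ) : ℂ) * M i j with hY
  set X := U * Y * Vᴴ with hX
  have hYn : ∀ i j, ‖Y i j‖ ^ 2 = (a i / (b j + t * a i)) ^ 2 * ‖M i j‖ ^ 2 := fun i j => by
    simp only [hY, of_apply, norm_mul, Complex.norm_real, mul_pow, Real.norm_eq_abs, sq_abs]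
  have e1 : ((∑ α, q α • ρ α) * X).trace.re =
      ∑ x : n × n, a x.1 * (a x.1 / (b x.2 + t * a x.1)) * ‖M x.1 x.2‖ ^ 2 := by
    have : ((∑ α, q α • ρ α) * X).trace = (diagonal (fun i => (a i : ℂ)) * Y * Mᴴ).trace := by
      rw [hAeq, hX, hM, conjTranspose_mul, conjTranspose_conjTranspose]
      calc _ = (U * (diagonal (fun i => (a i : ℂ)) * (Uᴴ * U) * Y * Vᴴ)).trace := by
            simp only [Matrix.mul_assoc]
        _ = _ := by rw [hUU, trace_mul_comm]; simp only [Matrix.mul_assoc, Matrix.one_mul]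
    rw [this, Fintype.sum_prod_type]
    simp only [trace, diag_apply, mul_apply (N := Mᴴ), diagonal_mul, conjTranspose_apply,
      Complex.re_sum]
    refine Finset.sum_congr rfl fun i _ => Finset.sum_congr rfl fun j _ => ?_
    have : (a i : ℂ) * Y i j * star (M i j) =
        ((a i * (a i / (b j + t * a i)) * ‖M i j‖ ^ 2 : ℝ) : ℂ) := by
      rw [hY, of_apply, Complex.star_def, mul_assoc, mul_assoc, Complex.mul_conj']
      push_cast
      ring
    rw [this, Complex.ofReal_re]
  have e2 : (X * (∑ α, p α • ρ α) * Xᴴ).trace.re =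
      ∑ x : n × n, b x.2 * ‖Y x.1 x.2‖ ^ 2 := by
    have : (X * (∑ α, p α • ρ α) * Xᴴ).trace =
        (diagonal (fun _ => ((1 : ℝ) : ℂ)) * Y * diagonal (fun i => (b i : ℂ)) * Yᴴ).trace := by
      rw [hBeq, hX, conjTranspose_mul, conjTranspose_mul, conjTranspose_conjTranspose]
      calc _ = (U * (Y * (Vᴴ * V) * diagonal (fun i => (b i : ℂ)) * (Vᴴ * V) * Yᴴ * Uᴴ)).trace := by
            simp only [Matrix.mul_assoc]
        _ = (Y * diagonal (fun i => (b i : ℂ)) * Yᴴ * (Uᴴ * U)).trace := by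
            rw [hVV, trace_mul_comm]; simp only [Matrix.mul_assoc, Matrix.one_mul]
        _ = _ := by simp [hUU]
    rw [this, trace_diagonal_mul_mul_diagonal_mul_conjTranspose, Complex.ofReal_re,
      Fintype.sum_prod_type]
    exact Finset.sum_congr rfl fun i _ => Finset.sum_congr rfl fun j _ => by ring
  have e3 : (Xᴴ * (∑ α, q α • ρ α) * X).trace.re =
      ∑ x : n × n, a x.1 * ‖Y x.1 x.2‖ ^ 2 := by
    have : (Xᴴ * (∑ α, q α • ρ α) * X).trace =
        (diagonal (fun i => (a i : ℂ)) * Y * diagonal (fun _ => ((1 : ℝ) : ℂ)) * Yᴴ).trace := by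
      rw [hAeq, hX, conjTranspose_mul, conjTranspose_mul, conjTranspose_conjTranspose]
      calc _ = (V * (Yᴴ * (Uᴴ * U) * diagonal (fun i => (a i : ℂ)) * (Uᴴ * U) * Y * Vᴴ)).trace := by
            simp only [Matrix.mul_assoc]
        _ = (Yᴴ * (diagonal (fun i => (a i : ℂ)) * Y * (Vᴴ * V))).trace := by
            rw [hUU, trace_mul_comm]; simp only [Matrix.mul_assoc, Matrix.one_mul]
        _ = _ := by rw [hVV, trace_mul_comm]; simp
    rw [this, trace_diagonal_mul_mul_diagonal_mul_conjTranspose, Complex.ofReal_re,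
      Fintype.sum_prod_type]
    exact Finset.sum_congr rfl fun i _ => Finset.sum_congr rfl fun j _ => by ring
  calc _ = 2 * ((∑ α, q α • ρ α) * X).trace.re - (X * (∑ α, p α • ρ α) * Xᴴ).trace.re -
        t * (Xᴴ * (∑ α, q α • ρ α) * X).trace.re := by
        rw [e1, e2, e3, Finset.mul_sum, Finset.mul_sum, ← Finset.sum_sub_distrib,
          ← Finset.sum_sub_distrib]
        refine Finset.sum_congr rfl fun x _ => ?_
        have hpos : b x.2 + t * a x.1 ≠ 0 := by have := ha x.1; have := hb x.2; positivity
        have hc : (b x.2 + t * a x.1) * (a x.1 / (b x.2 + t * a x.1)) = a x.1 :=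
          mul_div_cancel₀ _ hpos
        have hd : a x.1 ^ 2 / (b x.2 + t * a x.1) = a x.1 * (a x.1 / (b x.2 + t * a x.1)) := by
          ring
        rw [hYn, hd]
        linear_combination (‖M x.1 x.2‖ ^ 2 * (a x.1 / (b x.2 + t * a x.1))) * hc
    _ = ∑ α, (2 * q α * (ρ α * X).trace.re - p α * (X * ρ α * Xᴴ).trace.re -
          t * q α * (Xᴴ * ρ α * X).trace.re) := by
        have h1 := re_trace_sum_smul_mul q ρ 1 X
        simp only [Matrix.one_mul] at h1
        rw [h1, re_trace_sum_smul_mul, re_trace_sum_smul_mul, Finset.mul_sum, Finset.mul_sum,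
          ← Finset.sum_sub_distrib, ← Finset.sum_sub_distrib]
        exact Finset.sum_congr rfl fun α _ => by ring
    _ ≤ _ := Finset.sum_le_sum fun α _ =>
        two_mul_re_trace_sub_le (hρ α) (hρtr α) X (hp α) (hq α) ht (hqp α)

lemma sum_norm_sq_row_of_mul_conjTranspose_eq_one {M : Matrix n n ℂ} (hM : M * Mᴴ = 1) (i : n) :
    ∑ j, ‖M i j‖ ^ 2 = 1 := by
  have h := congrFun (congrFun hM i) i
  simp only [mul_apply, conjTranspose_apply, Complex.star_def, Complex.mul_conj', one_apply_eq] at h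
  exact_mod_cast h

lemma eigenvectorUnitary_conjTranspose_mul_mul_conjTranspose {A B : Matrix n n ℂ}
    (hA : A.IsHermitian) (hB : B.IsHermitian) :
    ((hA.eigenvectorUnitary : Matrix n n ℂ)ᴴ * (hB.eigenvectorUnitary : Matrix n n ℂ)) *
      ((hA.eigenvectorUnitary : Matrix n n ℂ)ᴴ * (hB.eigenvectorUnitary : Matrix n n ℂ))ᴴ = 1 :=
  Unitary.coe_mul_star_self (star hA.eigenvectorUnitary * hB.eigenvectorUnitary)

end MatrixKernel

lemma qRelEntropy_eq_sum {d : ℕ} {A B : Matrix (Fin d) (Fin d) ℂ}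
    (hA : A.IsHermitian) (hB : B.IsHermitian) :
    qRelEntropy A B = ∑ x : Fin d × Fin d,
      ‖((hA.eigenvectorUnitary : Matrix (Fin d) (Fin d) ℂ)ᴴ *
        (hB.eigenvectorUnitary : Matrix (Fin d) (Fin d) ℂ)) x.1 x.2‖ ^ 2 *
        (hA.eigenvalues x.1 * (Real.log (hA.eigenvalues x.1) - Real.log (hB.eigenvalues x.2))) := by
  have hM := eigenvectorUnitary_conjTranspose_mul_mul_conjTranspose hA hB
  have hAeq := IsHermitian.eq_eigenvectorUnitary_mul hA
  have hUU : (hA.eigenvectorUnitary : Matrix (Fin d) (Fin d) ℂ)ᴴ *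
    (hA.eigenvectorUnitary : Matrix (Fin d) (Fin d) ℂ) = 1 :=
    Unitary.coe_star_mul_self hA.eigenvectorUnitary
  simp only [qRelEntropy, matLog, dif_pos hA, dif_pos hB, star_eq_conjTranspose, mul_sub, trace_sub]
  set U : Matrix (Fin d) (Fin d) ℂ := hA.eigenvectorUnitary.1
  set V : Matrix (Fin d) (Fin d) ℂ := hB.eigenvectorUnitary.1
  set a := hA.eigenvalues
  set b := hB.eigenvalues
  set M := Uᴴ * V with hMdef
  have key : ∀ (W : Matrix (Fin d) (Fin d) ℂ) (y : Fin d → ℝ),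
      (A * (W * diagonal (fun i => (y i : ℂ)) * Wᴴ)).trace =
        ((∑ i, ∑ j, a i * ‖(Uᴴ * W) i j‖ ^ 2 * y j : ℝ) : ℂ) := fun W y => by
    rw [← trace_diagonal_mul_mul_diagonal_mul_conjTranspose, conjTranspose_mul,
      conjTranspose_conjTranspose, hAeq]
    calc _ = (U * (diagonal (fun i => (a i : ℂ)) * (Uᴴ * W) *
          diagonal (fun i => (y i : ℂ)) * Wᴴ)).trace := by simp only [Matrix.mul_assoc]
      _ = _ := by rw [trace_mul_comm]; simp only [Matrix.mul_assoc]
  have hlog : ∑ i, ∑ j, a i * ‖(Uᴴ * U) i j‖ ^ 2 * Real.log (a j) =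
      ∑ i, ∑ j, a i * ‖M i j‖ ^ 2 * Real.log (a i) := by
    refine Finset.sum_congr rfl fun i _ => ?_
    rw [← Finset.sum_mul, ← Finset.mul_sum, sum_norm_sq_row_of_mul_conjTranspose_eq_one hM, hUU]
    simp [one_apply, apply_ite]
  rw [Complex.sub_re, key U (fun i => Real.log (a i)), key V (fun i => Real.log (b i)),
    Complex.ofReal_re, Complex.ofReal_re, hlog, Fintype.sum_prod_type, ← Finset.sum_sub_distrib]
  refine Finset.sum_congr rfl fun i _ => ?_
  rw [← Finset.sum_sub_distrib]
  exact Finset.sum_congr rfl fun j _ => by ring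

/-- The relative entropy of two mixtures of the same states is at most the classical relative
entropy of the mixing weights. -/
theorem qRelEntropy_sum_smul_le {d : ℕ} {ι : Type*} [Fintype ι] (p q : ι → ℝ)
    (hp : ∀ α, 0 ≤ p α) (hq : ∀ α, 0 ≤ q α) (hqp : ∀ α, q α = 0 ∨ 0 < p α)
    (ρ : ι → Matrix (Fin d) (Fin d) ℂ) (hρ : ∀ α, (ρ α).PosSemidef)
    (hρtr : ∀ α, (ρ α).trace = 1) (hB : (∑ α, p α • ρ α).PosDef) :
    qRelEntropy (∑ α, q α • ρ α) (∑ α, p α • ρ α) ≤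
      ∑ α, q α * (Real.log (q α) - Real.log (p α)) := by
  have hA : (∑ α, q α • ρ α).PosSemidef :=
    posSemidef_sum _ fun α _ => (hρ α).smul (hq α)
  rw [qRelEntropy_eq_sum hA.isHermitian hB.isHermitian]
  refine sum_mul_log_sub_log_le (I := Fin d × Fin d) _ (fun x => hA.isHermitian.eigenvalues x.1)
    (fun x => hB.isHermitian.eigenvalues x.2) q p (fun x => hA.eigenvalues_nonneg x.1)
    (fun x => Or.inr (hB.eigenvalues_pos x.2)) hq hqp ?_
    (fun t ht => sum_kernel_eigenvalues_le p q hp hq hqp ρ hρ hρtr hA hB ht)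
  have htr : (∑ α, q α • ρ α).trace = ((∑ α, q α : ℝ) : ℂ) := by
    simp [trace_sum, hρtr]
  rw [hA.isHermitian.trace_eq_sum_eigenvalues] at htr
  rw [Fintype.sum_prod_type]
  simp only [← Finset.sum_mul, sum_norm_sq_row_of_mul_conjTranspose_eq_one
    (eigenvectorUnitary_conjTranspose_mul_mul_conjTranspose hA.isHermitian hB.isHermitian), one_mul]
  simpa using congrArg Complex.re htr

open scoped MatrixOrder Matrix.Norms.L2Operator in
lemma povProb_nonneg {d : ℕ} {Ω : Type*} {E : Ω → Matrix (Fin d) (Fin d) ℂ} {ω : Ω}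
    (hE : (E ω).PosSemidef) {ρ : Matrix (Fin d) (Fin d) ℂ} (hρ : ρ.PosSemidef) :
    0 ≤ povProb E ρ ω := by
  obtain ⟨C, hC⟩ := CStarAlgebra.nonneg_iff_eq_star_mul_self.1 hρ.nonneg
  rw [star_eq_conjTranspose] at hC
  have h := (Complex.nonneg_iff.1 (hE.mul_mul_conjTranspose_same C).trace_nonneg).1
  rwa [trace_mul_comm, ← Matrix.mul_assoc, ← hC, trace_mul_comm] at h

lemma povProb_sum_smul {d : ℕ} {Ω ι : Type*} [Fintype ι] (E : Ω → Matrix (Fin d) (Fin d) ℂ)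
    (p : ι → ℝ) (ρ : ι → Matrix (Fin d) (Fin d) ℂ) (ω : Ω) :
    povProb E (∑ α, p α • ρ α) ω = ∑ α, p α * povProb E (ρ α) ω := by
  simp [povProb, Finset.mul_sum, trace_sum]

lemma sum_povProb {d : ℕ} {Ω : Type*} [Fintype Ω] {E : Ω → Matrix (Fin d) (Fin d) ℂ}
    (hE : ∑ ω, E ω = 1) (ρ : Matrix (Fin d) (Fin d) ℂ) : ∑ ω, povProb E ρ ω = ρ.trace.re := by
  simp only [povProb, ← Complex.re_sum, ← trace_sum, ← Finset.sum_mul, hE, Matrix.one_mul]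

/-- Scutaru's lower bound on the classical mutual information. -/
theorem scutaru_bound {d : ℕ} (hd : 1 ≤ d)
    {A Ω : Type*} [Fintype A] [Fintype Ω]
    (p : A → ℝ) (hp : ∀ α, 0 ≤ p α) (hp1 : ∑ α, p α = 1)
    (ρ : A → Matrix (Fin d) (Fin d) ℂ)
    (hρ : ∀ α, (ρ α).PosSemidef) (hρtr : ∀ α, (ρ α).trace = 1)
    (E : Ω → Matrix (Fin d) (Fin d) ℂ)
    (hEpos : ∀ ω, (E ω).PosSemidef) (hEsum : ∑ ω, E ω = 1)
    (hη : (∑ α, p α • ρ α).PosDef) :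
    let η := ∑ α, p α • ρ α
    let pf := povProb E η
    let ε := fun ω => ∑ α, (p α * povProb E (ρ α) ω / pf ω) • ρ α
    mutualInfo p ρ E ≥ chiQuantity pf ε ∧ ∑ ω, pf ω • ε ω = η := by
  intro η pf ε
  have hP : ∀ α ω, 0 ≤ p α * povProb E (ρ α) ω := fun α ω =>
    mul_nonneg (hp α) (povProb_nonneg (hEpos ω) (hρ α))
  have hpf : ∀ ω, pf ω = ∑ α, p α * povProb E (ρ α) ω := povProb_sum_smul E p ρ
  have hpf0 : ∀ ω, 0 ≤ pf ω := fun ω => hpf ω ▸ Finset.sum_nonneg fun α _ => hP α ω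
  have hzero : ∀ α ω, pf ω = 0 → p α * povProb E (ρ α) ω = 0 := fun α ω h =>
    (Finset.sum_eq_zero_iff_of_nonneg fun β _ => hP β ω).1 ((hpf ω).symm.trans h) α (mem_univ α)
  have hcancel : ∀ α ω, pf ω * (p α * povProb E (ρ α) ω / pf ω) = p α * povProb E (ρ α) ω :=
    fun α ω => mul_div_cancel_of_imp' (hzero α ω)
  have havg : ∑ ω, pf ω • ε ω = η := by
    simp only [ε, Finset.smul_sum, smul_smul, hcancel]
    rw [Finset.sum_comm]
    refine Finset.sum_congr rfl fun α _ => ?_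
    rw [← Finset.sum_smul, ← Finset.mul_sum, sum_povProb hEsum, hρtr, Complex.one_re, mul_one]
  refine ⟨?_, havg⟩
  have hmut : mutualInfo p ρ E = ∑ ω, ∑ α, (p α * povProb E (ρ α) ω) *
      (Real.log (p α * povProb E (ρ α) ω / pf ω) - Real.log (p α)) := by
    rw [mutualInfo, Finset.sum_filter, Fintype.sum_prod_type, Finset.sum_comm]
    refine Finset.sum_congr rfl fun ω _ => Finset.sum_congr rfl fun α _ => ?_
    split_ifs with h
    · have hpα : p α ≠ 0 := left_ne_zero_of_mul h.ne'
      have hpfω : pf ω ≠ 0 := fun h0 => h.ne' (hzero α ω h0)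
      rw [← Real.log_div (div_ne_zero h.ne' hpfω) hpα, div_div, mul_comm (pf ω)]
    · rw [le_antisymm (not_lt.1 h) (hP α ω), zero_mul]
  rw [ge_iff_le, hmut, chiQuantity, havg, Finset.sum_filter]
  refine Finset.sum_le_sum fun ω _ => ?_
  split_ifs with h
  · have hle := qRelEntropy_sum_smul_le p (fun α => p α * povProb E (ρ α) ω / pf ω) hp
      (fun α => div_nonneg (hP α ω) h.le)
      (fun α => (hp α).eq_or_lt.imp (fun h0 => by simp [← h0]) id) ρ hρ hρtr hη
    refine (mul_le_mul_of_nonneg_left hle h.le).trans_eq ?_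
    rw [Finset.mul_sum]
    exact Finset.sum_congr rfl fun α _ => by rw [← mul_assoc, hcancel]
  · have h0 : pf ω = 0 := le_antisymm (not_lt.1 h) (hpf0 ω)
    exact (Finset.sum_eq_zero fun α _ => by rw [hzero α ω h0, zero_mul]).ge
end
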